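/- Let α ∈ ℝ with q < α ≤ 1 and let φ ∈ (0, π). Define A := ((q α^{−1} e^{−iφ};q)_∞ / (q;q)_∞) · ( −(i e^{iφ} / (2 sin φ)) · ₁φ₁(q; q e^{−2iφ}; q, α e^{−iφ}) + ₁φ₁(q; q α^{−1} e^{−iφ}; q, q α^{−1} e^{iφ}) − 1 ) and B := θ_q(α e^{iφ}) / (e^{2iφ};q)_∞. Then lim_{n→−∞} ( f_n(e^{iφ}) − e^{−i n φ} A − e^{i n φ} B ) = 0. -/

import Mathlib

open Complex Filter Topology

/-- Finite q-Pochhammer symbol `(a;q)_n`. -/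
noncomputable def qp (q a : ℂ) (n : ℕ) : ℂ := ∏ k ∈ Finset.range n, (1 - a * q ^ k)

/-- Infinite q-Pochhammer symbol `(a;q)_∞`. -/
noncomputable def qpInf (q a : ℂ) : ℂ := ∏' k : ℕ, (1 - a * q ^ k)

/-- Theta function `θ_q(x) = (x;q)_∞ (q/x;q)_∞`. -/
noncomputable def theta (q x : ℂ) : ℂ := qpInf q x * qpInf q (q / x)

/-- Regularized confluent basic hypergeometric series `₁φ̃₁(0;b;q,w)`. -/
noncomputable def phiT (q b w : ℂ) : ℂ :=
  ∑' k : ℕ, qpInf q (b * q ^ k) * (-1) ^ k * q ^ (k * (k - 1) / 2) * w ^ k / qp q q k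

/-- The solution `f_n(z)`. -/
noncomputable def fseq (q α z : ℂ) (n : ℤ) : ℂ :=
  (-1) ^ n * α ^ (-n) * q ^ (n * (n + 1) / 2) *
    phiT q (q ^ (n + 1) / (α * z)) (z * q ^ (n + 1) / α)

/-- The solution `g_n(z)`. -/
noncomputable def gseq (q α z : ℂ) (n : ℤ) : ℂ :=
  z ^ (-n) * phiT q (α * z * q ^ (1 - n)) (q * z ^ 2)

/-- The series `₁φ₁(q;b;q,w) = ∑ (-1)^k q^{k(k-1)/2} w^k / (b;q)_k`. -/
noncomputable def phiOne (q b w : ℂ) : ℂ :=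
  ∑' k : ℕ, (-1) ^ k * q ^ (k * (k - 1) / 2) * w ^ k / qp q b k

/-- The terms `(-1)^k q^{k(k-1)/2} y^k` of the partial theta series. -/
noncomputable def thetaTerm (q y : ℂ) (k : ℕ) : ℂ := (-1) ^ k * q ^ (k * (k - 1) / 2) * y ^ k

@[simp] lemma thetaTerm_zero (q y : ℂ) : thetaTerm q y 0 = 1 := by simp [thetaTerm]

lemma thetaTerm_succ (q y : ℂ) (k : ℕ) :
    thetaTerm q y (k + 1) = -(q ^ k * y) * thetaTerm q y k := by
  have h : (k + 1) * (k + 1 - 1) / 2 = k * (k - 1) / 2 + k := by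
    rw [← Finset.sum_range_id, ← Finset.sum_range_id, Finset.sum_range_succ]
  rw [thetaTerm, thetaTerm, h]
  ring

lemma thetaTerm_mul (q x y : ℂ) (k : ℕ) : thetaTerm q (x * y) k = x ^ k * thetaTerm q y k := by
  rw [thetaTerm, thetaTerm]; ring

lemma thetaTerm_add (q y : ℂ) (j k : ℕ) :
    thetaTerm q y (j + k) = thetaTerm q (y * q ^ k) j * thetaTerm q y k := by
  induction j with
  | zero => simp
  | succ j ih =>
    rw [show j + 1 + k = (j + k) + 1 by ring, thetaTerm_succ, ih, thetaTerm_succ]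
    ring

lemma norm_thetaTerm_mul_pow_le {q : ℂ} (hq : ‖q‖ < 1) (y : ℂ) (j k : ℕ) :
    ‖thetaTerm q (y * q ^ k) j‖ ≤ ‖thetaTerm q y j‖ := by
  rw [mul_comm, thetaTerm_mul, norm_mul, norm_pow, norm_pow]
  exact mul_le_of_le_one_left (norm_nonneg _)
    (pow_le_one₀ (by positivity) (pow_le_one₀ (by positivity) hq.le))

lemma summable_norm_thetaTerm {q : ℂ} (hq : ‖q‖ < 1) (y : ℂ) :
    Summable fun k => ‖thetaTerm q y k‖ := by
  refine summable_of_ratio_norm_eventually_le (r := 1 / 2) (by norm_num) ?_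
  have h : Tendsto (fun k : ℕ => ‖q‖ ^ k * ‖y‖) atTop (𝓝 0) := by
    simpa using (tendsto_pow_atTop_nhds_zero_of_lt_one (norm_nonneg q) hq).mul_const ‖y‖
  filter_upwards [h.eventually (gt_mem_nhds (show (0 : ℝ) < 1 / 2 by norm_num))] with k hk
  rw [norm_norm, norm_norm, thetaTerm_succ, norm_mul, norm_neg, norm_mul, norm_pow]
  gcongr

lemma summable_thetaTerm {q : ℂ} (hq : ‖q‖ < 1) (y : ℂ) : Summable (thetaTerm q y) :=
  (summable_norm_thetaTerm hq y).of_norm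

@[simp] lemma qp_zero (q a : ℂ) : qp q a 0 = 1 := by simp [qp]

lemma qp_succ (q a : ℂ) (n : ℕ) : qp q a (n + 1) = qp q a n * (1 - a * q ^ n) :=
  Finset.prod_range_succ _ _

lemma qp_self_succ (q : ℂ) (n : ℕ) : qp q q (n + 1) = qp q q n * (1 - q ^ (n + 1)) := by
  rw [qp_succ, pow_succ']

lemma summable_norm_neg_mul_pow {q : ℂ} (hq : ‖q‖ < 1) (a : ℂ) :
    Summable fun k : ℕ => ‖-(a * q ^ k)‖ := by
  simp only [norm_neg, norm_mul, norm_pow]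
  exact (summable_geometric_of_lt_one (norm_nonneg q) hq).mul_left _

lemma multipliable_qpInf {q : ℂ} (hq : ‖q‖ < 1) (a : ℂ) :
    Multipliable fun k : ℕ => 1 - a * q ^ k := by
  simpa only [sub_eq_add_neg] using
    multipliable_one_add_of_summable (summable_norm_neg_mul_pow hq a)

lemma tendsto_qp {q : ℂ} (hq : ‖q‖ < 1) (a : ℂ) :
    Tendsto (qp q a) atTop (𝓝 (qpInf q a)) :=
  (multipliable_qpInf hq a).hasProd.tendsto_prod_nat

lemma qpInf_eq_one_sub_mul {q : ℂ} (hq : ‖q‖ < 1) (a : ℂ) :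
    qpInf q a = (1 - a) * qpInf q (q * a) := by
  have h : (fun k : ℕ => 1 - a * q ^ (k + 1)) = fun k : ℕ => 1 - q * a * q ^ k := by
    funext k; ring
  rw [qpInf, tprod_eq_zero_mul' (by rw [h]; exact multipliable_qpInf hq _), h, qpInf]
  simp

lemma qpInf_eq_qp_mul {q : ℂ} (hq : ‖q‖ < 1) (a : ℂ) (n : ℕ) :
    qpInf q a = qp q a n * qpInf q (a * q ^ n) := by
  induction n with
  | zero => simp
  | succ n ih =>
    rw [ih, qpInf_eq_one_sub_mul hq (a * q ^ n), qp_succ]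
    ring_nf

lemma qpInf_ne_zero {q : ℂ} (hq : ‖q‖ < 1) {a : ℂ} (ha : ∀ k : ℕ, a * q ^ k ≠ 1) :
    qpInf q a ≠ 0 := by
  have := tprod_one_add_ne_zero_of_summable (f := fun k : ℕ => -(a * q ^ k))
    (fun k => by rw [← sub_eq_add_neg]; exact sub_ne_zero.2 (ha k).symm)
    (summable_norm_neg_mul_pow hq a)
  simpa only [qpInf, sub_eq_add_neg] using this

lemma mul_pow_ne_one {q : ℂ} (hq : ‖q‖ < 1) {a : ℂ} (ha : ‖a‖ < 1) (k : ℕ) :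
    a * q ^ k ≠ 1 := by
  intro h
  have h1 : ‖a * q ^ k‖ < 1 := by
    rw [norm_mul, norm_pow]
    exact mul_lt_one_of_nonneg_of_lt_one_left (norm_nonneg _) ha
      (pow_le_one₀ (norm_nonneg _) hq.le)
  rw [h, norm_one] at h1
  exact lt_irrefl _ h1

lemma qpInf_ne_zero_of_norm_lt {q : ℂ} (hq : ‖q‖ < 1) {a : ℂ} (ha : ‖a‖ < 1) :
    qpInf q a ≠ 0 := qpInf_ne_zero hq (mul_pow_ne_one hq ha)

lemma qp_ne_zero_of_qpInf {q : ℂ} (hq : ‖q‖ < 1) {a : ℂ} (ha : qpInf q a ≠ 0) (n : ℕ) :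
    qp q a n ≠ 0 := by
  rw [qpInf_eq_qp_mul hq a n] at ha
  exact left_ne_zero_of_mul ha

lemma qp_self_ne_zero {q : ℂ} (hq : ‖q‖ < 1) (n : ℕ) : qp q q n ≠ 0 :=
  qp_ne_zero_of_qpInf hq (qpInf_ne_zero_of_norm_lt hq hq) n

lemma tendsto_inv_qp_self {q : ℂ} (hq : ‖q‖ < 1) :
    Tendsto (fun n => (qp q q n)⁻¹) atTop (𝓝 (qpInf q q)⁻¹) :=
  (tendsto_qp hq q).inv₀ (qpInf_ne_zero_of_norm_lt hq hq)

lemma exists_norm_le_of_tendsto {f : ℕ → ℂ} {l : ℂ} (h : Tendsto f atTop (𝓝 l)) :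
    ∃ C : ℝ, 0 ≤ C ∧ ∀ n, ‖f n‖ ≤ C := by
  obtain ⟨C, hC⟩ := (Metric.isBounded_range_of_tendsto f h).exists_norm_le
  exact ⟨C, (norm_nonneg _).trans (hC _ ⟨0, rfl⟩), fun n => hC _ ⟨n, rfl⟩⟩

lemma inv_qp_self_succ_mul {q : ℂ} (hq : ‖q‖ < 1) (n : ℕ) :
    (qp q q (n + 1))⁻¹ * (1 - q ^ (n + 1)) = (qp q q n)⁻¹ := by
  have h := qp_self_ne_zero hq (n + 1)
  rw [qp_self_succ] at h ⊢
  have h1 := left_ne_zero_of_mul h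
  have h2 := right_ne_zero_of_mul h
  field_simp

/-- Summable sequences twisted by `(q^n)^k` converge to their zeroth term. -/
lemma tendsto_tsum_mul_pow {q : ℂ} (hq : ‖q‖ < 1) {a : ℕ → ℂ} (ha : Summable fun k => ‖a k‖) :
    Tendsto (fun n : ℕ => ∑' k, a k * (q ^ n) ^ k) atTop (𝓝 (a 0)) := by
  have h := tendsto_tsum_of_dominated_convergence (𝓕 := atTop)
    (f := fun (n : ℕ) k => a k * (q ^ n) ^ k) (g := fun k => if k = 0 then a 0 else 0) ha ?_ ?_
  · simpa using h
  · intro k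
    rcases Nat.eq_zero_or_pos k with rfl | hk
    · simp
    · simp only [hk.ne', if_false]
      have := ((tendsto_pow_atTop_nhds_zero_of_norm_lt_one hq).pow k).const_mul (a k)
      simpa [hk.ne'] using this
  · refine Eventually.of_forall fun n k => ?_
    rw [norm_mul, norm_pow, norm_pow]
    exact mul_le_of_le_one_right (norm_nonneg _)
      (pow_le_one₀ (by positivity) (pow_le_one₀ (by positivity) hq.le))

lemma summable_norm_mul_inv_qp {q : ℂ} (hq : ‖q‖ < 1) {a : ℕ → ℂ}
    (ha : Summable fun k => ‖a k‖) : Summable fun k => ‖a k * (qp q q k)⁻¹‖ := by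
  obtain ⟨C, hC0, hC⟩ := exists_norm_le_of_tendsto (tendsto_inv_qp_self hq)
  refine Summable.of_nonneg_of_le (fun _ => norm_nonneg _) (fun k => ?_) (ha.mul_right C)
  rw [norm_mul]
  exact mul_le_mul_of_nonneg_left (hC k) (norm_nonneg _)

/-- Iterating a `q`-difference equation of first order. -/
lemma eq_qp_mul_of_forall {q : ℂ} {E : ℂ → ℂ} (h : ∀ x, E x = (1 - x) * E (q * x)) (x : ℂ)
    (n : ℕ) : E x = qp q x n * E (x * q ^ n) := by
  induction n with
  | zero => simp
  | succ n ih => rw [ih, h (x * q ^ n), qp_succ]; ring_nf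

/-- Euler's expansion of `(y;q)_∞`. -/
lemma tsum_thetaTerm_mul_inv_qp {q : ℂ} (hq : ‖q‖ < 1) (y : ℂ) :
    ∑' k, thetaTerm q y k * (qp q q k)⁻¹ = qpInf q y := by
  have hs (x : ℂ) := summable_norm_mul_inv_qp hq (summable_norm_thetaTerm hq x)
  have hE (x : ℂ) : ∑' k, thetaTerm q x k * (qp q q k)⁻¹ =
      (1 - x) * ∑' k, thetaTerm q (q * x) k * (qp q q k)⁻¹ := by
    have h1 : ∑' k, thetaTerm q x k * (qp q q k)⁻¹ -
        ∑' k, thetaTerm q (q * x) k * (qp q q k)⁻¹ =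
        ∑' k, thetaTerm q x k * (qp q q k)⁻¹ * (1 - q ^ k) := by
      rw [← (hs x).of_norm.tsum_sub (hs (q * x)).of_norm]
      exact tsum_congr fun k => by rw [thetaTerm_mul]; ring
    have h2 : Summable fun k => thetaTerm q x k * (qp q q k)⁻¹ * (1 - q ^ k) := by
      refine ((hs x).of_norm.sub (hs (q * x)).of_norm).congr fun k => ?_
      rw [thetaTerm_mul]; ring
    have h3 : ∑' k, thetaTerm q x k * (qp q q k)⁻¹ * (1 - q ^ k) =
        -x * ∑' k, thetaTerm q (q * x) k * (qp q q k)⁻¹ := by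
      rw [h2.tsum_eq_zero_add, ← tsum_mul_left]
      simp only [pow_zero, sub_self, mul_zero, zero_add]
      refine tsum_congr fun k => ?_
      rw [mul_assoc, inv_qp_self_succ_mul hq, thetaTerm_succ, thetaTerm_mul]
      ring
    linear_combination h1 + h3
  have hlim : Tendsto (fun n : ℕ => qp q y n * ∑' k, thetaTerm q (y * q ^ n) k * (qp q q k)⁻¹)
      atTop (𝓝 (qpInf q y * 1)) := by
    refine (tendsto_qp hq y).mul ?_
    have := tendsto_tsum_mul_pow hq (hs y)
    simp only [thetaTerm_zero, qp_zero, inv_one, mul_one] at this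
    refine this.congr fun n => tsum_congr fun k => ?_
    rw [mul_comm y, thetaTerm_mul]; ring
  rw [mul_one] at hlim
  refine tendsto_nhds_unique (hlim.congr fun n => ?_) tendsto_const_nhds |>.symm
  exact (eq_qp_mul_of_forall
    (E := fun x => ∑' k, thetaTerm q x k * (qp q q k)⁻¹) hE y n).symm

/-- Euler's expansion of `1 / (x;q)_∞`. -/
lemma tsum_pow_mul_inv_qp {q : ℂ} (hq : ‖q‖ < 1) {x : ℂ} (hx : ‖x‖ < 1) :
    ∑' k, x ^ k * (qp q q k)⁻¹ = (qpInf q x)⁻¹ := by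
  have hs {x : ℂ} (hx : ‖x‖ < 1) : Summable fun k => ‖x ^ k * (qp q q k)⁻¹‖ := by
    refine summable_norm_mul_inv_qp hq ?_
    simpa only [norm_pow] using summable_geometric_of_lt_one (norm_nonneg x) hx
  have hxn (n : ℕ) : ‖x * q ^ n‖ < 1 := by
    rw [norm_mul, norm_pow]
    exact mul_lt_one_of_nonneg_of_lt_one_left (norm_nonneg _) hx
      (pow_le_one₀ (norm_nonneg _) hq.le)
  have hE {x : ℂ} (hx : ‖x‖ < 1) : ∑' k, (x * q) ^ k * (qp q q k)⁻¹ =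
      (1 - x) * ∑' k, x ^ k * (qp q q k)⁻¹ := by
    have hqx : ‖x * q‖ < 1 := by
      rw [norm_mul]
      exact mul_lt_one_of_nonneg_of_lt_one_left (norm_nonneg _) hx hq.le
    have h1 : ∑' k, x ^ k * (qp q q k)⁻¹ - ∑' k, (x * q) ^ k * (qp q q k)⁻¹ =
        ∑' k, x ^ k * (qp q q k)⁻¹ * (1 - q ^ k) := by
      rw [← (hs hx).of_norm.tsum_sub (hs hqx).of_norm]
      exact tsum_congr fun k => by ring
    have h2 : Summable fun k => x ^ k * (qp q q k)⁻¹ * (1 - q ^ k) :=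
      ((hs hx).of_norm.sub (hs hqx).of_norm).congr fun k => by ring
    have h3 : ∑' k, x ^ k * (qp q q k)⁻¹ * (1 - q ^ k) = x * ∑' k, x ^ k * (qp q q k)⁻¹ := by
      rw [h2.tsum_eq_zero_add, ← tsum_mul_left]
      simp only [pow_zero, sub_self, mul_zero, zero_add]
      refine tsum_congr fun k => ?_
      rw [mul_assoc, inv_qp_self_succ_mul hq]
      ring
    linear_combination -h1 - h3
  have hiter (n : ℕ) : ∑' k, (x * q ^ n) ^ k * (qp q q k)⁻¹ =
      qp q x n * ∑' k, x ^ k * (qp q q k)⁻¹ := by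
    induction n with
    | zero => simp
    | succ n ih =>
      rw [pow_succ, ← mul_assoc, hE (hxn n), ih, qp_succ]
      ring
  have hlim := tendsto_tsum_mul_pow hq (hs hx)
  simp only [pow_zero, qp_zero, inv_one, mul_one] at hlim
  have h := tendsto_nhds_unique hlim
    (((tendsto_qp hq x).mul_const (∑' k, x ^ k * (qp q q k)⁻¹)).congr fun n => by
      rw [← hiter]; exact tsum_congr fun k => by ring)
  exact eq_inv_of_mul_eq_one_right h.symm

lemma tendsto_qpInf_mul_pow {q : ℂ} (hq : ‖q‖ < 1) (x : ℂ) :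
    Tendsto (fun n : ℕ => qpInf q (x * q ^ n)) atTop (𝓝 1) := by
  have h := tendsto_tsum_mul_pow hq (summable_norm_mul_inv_qp hq (summable_norm_thetaTerm hq x))
  simp only [thetaTerm_zero, qp_zero, inv_one, mul_one] at h
  refine h.congr fun n => ?_
  rw [← tsum_thetaTerm_mul_inv_qp hq]
  refine tsum_congr fun k => ?_
  rw [mul_comm x, thetaTerm_mul]; ring

/-- The entire function `∑ (-1)^k q^{k(k-1)/2} y^k (x q^k;q)_∞`. -/
noncomputable def thetaQpSum (q y x : ℂ) : ℂ := ∑' k : ℕ, thetaTerm q y k * qpInf q (x * q ^ k)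

lemma summable_thetaTerm_mul_qpInf {q : ℂ} (hq : ‖q‖ < 1) (y x : ℂ) :
    Summable fun k : ℕ => thetaTerm q y k * qpInf q (x * q ^ k) := by
  obtain ⟨C, hC0, hC⟩ := exists_norm_le_of_tendsto (tendsto_qpInf_mul_pow hq x)
  refine Summable.of_norm_bounded ((summable_norm_thetaTerm hq y).mul_right C) fun k => ?_
  rw [norm_mul]
  exact mul_le_mul_of_nonneg_left (hC k) (norm_nonneg _)

lemma thetaQpSum_sub {q : ℂ} (hq : ‖q‖ < 1) {y : ℂ} (hy : y ≠ 0) (x : ℂ) :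
    thetaQpSum q y x - thetaQpSum q y (q * x) = x / y * (thetaQpSum q y x - qpInf q x) := by
  have hs := summable_thetaTerm_mul_qpInf hq y x
  rw [thetaQpSum, thetaQpSum,
    ← hs.tsum_sub (summable_thetaTerm_mul_qpInf hq y (q * x)), hs.tsum_eq_zero_add]
  simp only [thetaTerm_zero, pow_zero, mul_one, one_mul, add_sub_cancel_left]
  rw [← tsum_mul_left]
  refine tsum_congr fun k => ?_
  rw [qpInf_eq_one_sub_mul hq (x * q ^ k), thetaTerm_succ,
    show x * q ^ (k + 1) = q * (x * q ^ k) by ring, show q * x * q ^ k = q * (x * q ^ k) by ring]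
  field_simp
  ring

lemma tendsto_thetaQpSum {q : ℂ} (hq : ‖q‖ < 1) (y x : ℂ) :
    Tendsto (fun n : ℕ => thetaQpSum q y (x * q ^ n)) atTop (𝓝 (∑' k, thetaTerm q y k)) := by
  obtain ⟨C, hC0, hC⟩ := exists_norm_le_of_tendsto (tendsto_qpInf_mul_pow hq x)
  refine tendsto_tsum_of_dominated_convergence ((summable_norm_thetaTerm hq y).mul_right C) ?_ ?_
  · intro k
    have := ((tendsto_qpInf_mul_pow hq (x * q ^ k))).const_mul (thetaTerm q y k)
    rw [mul_one] at this
    exact this.congr fun n => by ring_nf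
  · refine Eventually.of_forall fun n k => ?_
    rw [norm_mul, mul_assoc, ← pow_add]
    exact mul_le_mul_of_nonneg_left (hC _) (norm_nonneg _)

/-- The bilateral theta series `∑_{k ∈ ℤ} (-1)^k q^{k(k-1)/2} y^k`, split at `k = 0`. -/
noncomputable def thetaSeries (q y : ℂ) : ℂ :=
  ∑' k, thetaTerm q y k + ∑' k, thetaTerm q (q / y) k - 1

/-- A confluent form of Ramanujan's bilateral summation, before the product evaluation. -/
lemma thetaQpSum_add_eq_thetaSeries {q : ℂ} (hq : ‖q‖ < 1) {y : ℂ} (hy : y ≠ 0) (hq0 : q ≠ 0)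
    (b : ℂ) :
    qpInf q (q * b / y) * thetaQpSum q y (q * b) +
      qpInf q b * (thetaQpSum q (q / y) (q * b / y) - qpInf q (q * b / y)) =
      thetaSeries q y := by
  set F : ℂ → ℂ := fun b => qpInf q (q * b / y) * thetaQpSum q y (q * b) +
      qpInf q b * (thetaQpSum q (q / y) (q * b / y) - qpInf q (q * b / y)) with hF
  have hstep (b : ℂ) : F b = F (b * q) := by
    have h1 := thetaQpSum_sub hq hy (q * b)
    have h2 := thetaQpSum_sub hq (div_ne_zero hq0 hy) (q * b / y)
    have h3 := qpInf_eq_one_sub_mul hq b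
    have h4 := qpInf_eq_one_sub_mul hq (q * b / y)
    rw [show q * b / y / (q / y) = b by field_simp] at h2
    simp only [hF]
    rw [show q * (b * q) = q * (q * b) by ring, show q * (q * b) / y = q * (q * b / y) by ring,
      show b * q = q * b by ring]
    linear_combination (thetaQpSum q y (q * b) - qpInf q (q * b)) * h4 +
      (thetaQpSum q (q / y) (q * b / y) - qpInf q (q * b / y)) * h3 +
      qpInf q (q * (q * b / y)) * h1 + qpInf q (q * b) * h2
  have hiter (n : ℕ) : F (b * q ^ n) = F b := by
    induction n with
    | zero => simp
    | succ n ih => rw [pow_succ, ← mul_assoc, ← hstep, ih]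
  have e1 (n : ℕ) : q * (b * q ^ n) / y = q * b / y * q ^ n := by ring
  have e2 (n : ℕ) : q * (b * q ^ n) = q * b * q ^ n := by ring
  have hlim : Tendsto (fun n : ℕ => F (b * q ^ n)) atTop
      (𝓝 (1 * ∑' k, thetaTerm q y k + 1 * (∑' k, thetaTerm q (q / y) k - 1))) := by
    simp only [hF, e1]
    simp only [e2]
    exact ((tendsto_qpInf_mul_pow hq _).mul (tendsto_thetaQpSum hq _ _)).add
      ((tendsto_qpInf_mul_pow hq _).mul
        ((tendsto_thetaQpSum hq _ _).sub (tendsto_qpInf_mul_pow hq _)))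
  simp only [hiter] at hlim
  have h := tendsto_nhds_unique tendsto_const_nhds hlim
  simp only [hF] at h
  rw [h, thetaSeries]
  ring

lemma qpInf_pow_succ {q : ℂ} (hq : ‖q‖ < 1) (k : ℕ) :
    qpInf q (q * q ^ k) = qpInf q q * (qp q q k)⁻¹ := by
  rw [qpInf_eq_qp_mul hq q k, mul_right_comm, mul_inv_cancel₀ (qp_self_ne_zero hq k), one_mul]

/-- The Jacobi triple product identity. -/
lemma thetaSeries_eq {q : ℂ} (hq : ‖q‖ < 1) {y : ℂ} (hy : y ≠ 0) (hq0 : q ≠ 0) :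
    thetaSeries q y = qpInf q q * theta q y := by
  have h1 : qpInf q 1 = 0 := by rw [qpInf_eq_one_sub_mul hq]; simp
  rw [← thetaQpSum_add_eq_thetaSeries hq hy hq0 1, h1, zero_mul, add_zero, mul_one, theta,
    ← tsum_thetaTerm_mul_inv_qp hq y, thetaQpSum]
  simp only [qpInf_pow_succ hq]
  rw [tsum_congr fun k => mul_left_comm _ _ _, tsum_mul_left]
  ring

lemma phiOne_eq_tsum (q b w : ℂ) : phiOne q b w = ∑' k, thetaTerm q w k / qp q b k := rfl

lemma qpInf_mul_phiOne {q : ℂ} (hq : ‖q‖ < 1) {b : ℂ} (hb : qpInf q b ≠ 0) (w : ℂ) :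
    qpInf q b * phiOne q b w = thetaQpSum q w b := by
  rw [phiOne_eq_tsum, ← tsum_mul_left, thetaQpSum]
  refine tsum_congr fun k => ?_
  have := qp_ne_zero_of_qpInf hq hb k
  rw [qpInf_eq_qp_mul hq b k]
  field_simp

/-- The combination of two `₁φ₁` series that sums to a theta function. -/
lemma phiOne_add_phiOne {q : ℂ} (hq : ‖q‖ < 1) (hq0 : q ≠ 0) {y b : ℂ} (hy : y ≠ 0)
    (hb : qpInf q b ≠ 0) (hby : qpInf q (q * b / y) ≠ 0) :
    qpInf q (q * b / y) * ((1 - b)⁻¹ * phiOne q (q * b) y + phiOne q (q * b / y) (q / y) - 1) =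
      thetaSeries q y / qpInf q b := by
  have h3 := qpInf_eq_one_sub_mul hq b
  have hb' := hb
  rw [h3] at hb'
  have hb1 := left_ne_zero_of_mul hb'
  have hb2 := right_ne_zero_of_mul hb'
  rw [eq_div_iff hb, ← thetaQpSum_add_eq_thetaSeries hq hy hq0 b, ← qpInf_mul_phiOne hq hb2,
    ← qpInf_mul_phiOne hq hby, h3]
  field_simp
  ring

/-- The polynomials `∑_{j+k=N} w^j / ((q;q)_j (q;q)_k)`. -/
noncomputable def rogersSzego (q w : ℂ) (N : ℕ) : ℂ :=
  ∑ p ∈ Finset.HasAntidiagonal.antidiagonal N, (qp q q p.1)⁻¹ * (qp q q p.2)⁻¹ * w ^ p.1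

lemma one_sub_mul_rogersSzego {q : ℂ} (hq : ‖q‖ < 1) {w : ℂ} (hw : w ≠ 0) (N : ℕ) :
    (1 - w) * rogersSzego q w N =
      rogersSzego q (q * w) (N + 1) - w ^ (N + 1) * rogersSzego q (q * w⁻¹) (N + 1) := by
  have h1 : ∑ p ∈ Finset.HasAntidiagonal.antidiagonal (N + 1),
      (qp q q p.1)⁻¹ * (qp q q p.2)⁻¹ * (1 - q ^ p.1) * w ^ p.1 = w * rogersSzego q w N := by
    rw [Finset.Nat.sum_antidiagonal_succ, rogersSzego, Finset.mul_sum]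
    simp only [pow_zero, sub_self, mul_zero, zero_mul, zero_add]
    refine Finset.sum_congr rfl fun p _ => ?_
    rw [← inv_qp_self_succ_mul hq p.1]
    ring
  have h2 : ∑ p ∈ Finset.HasAntidiagonal.antidiagonal (N + 1),
      (qp q q p.1)⁻¹ * (qp q q p.2)⁻¹ * (1 - q ^ p.2) * w ^ p.1 = rogersSzego q w N := by
    rw [Finset.Nat.sum_antidiagonal_succ', rogersSzego]
    simp only [pow_zero, sub_self, mul_zero, zero_mul, zero_add]
    refine Finset.sum_congr rfl fun p _ => ?_
    rw [← inv_qp_self_succ_mul hq p.2]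
    ring
  have h3 : w ^ (N + 1) * rogersSzego q (q * w⁻¹) (N + 1) = ∑ p ∈ Finset.HasAntidiagonal.antidiagonal (N + 1),
      (qp q q p.1)⁻¹ * (qp q q p.2)⁻¹ * q ^ p.2 * w ^ p.1 := by
    rw [rogersSzego, ← Finset.Nat.sum_antidiagonal_swap, Finset.mul_sum]
    refine Finset.sum_congr rfl fun p hp => ?_
    rw [← Finset.HasAntidiagonal.mem_antidiagonal.1 hp]
    simp only [Prod.fst_swap, Prod.snd_swap]
    rw [pow_add, mul_pow, inv_pow]
    field_simp
  rw [h3, rogersSzego.eq_1 q (q * w), sub_mul, one_mul, ← h1]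
  nth_rewrite 1 [← h2]
  rw [← Finset.sum_sub_distrib, ← Finset.sum_sub_distrib]
  refine Finset.sum_congr rfl fun p _ => ?_
  ring

lemma tendsto_rogersSzego {q : ℂ} (hq : ‖q‖ < 1) {x : ℂ} (hx : ‖x‖ < 1) :
    Tendsto (rogersSzego q x) atTop (𝓝 ((qpInf q q)⁻¹ * (qpInf q x)⁻¹)) := by
  obtain ⟨C, hC0, hC⟩ := exists_norm_le_of_tendsto (tendsto_inv_qp_self hq)
  have hN (N : ℕ) : rogersSzego q x N = ∑' j, if j ∈ Finset.range (N + 1) then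
      (qp q q j)⁻¹ * (qp q q (N - j))⁻¹ * x ^ j else 0 := by
    rw [rogersSzego, Finset.Nat.sum_antidiagonal_eq_sum_range_succ
      (fun j k => (qp q q j)⁻¹ * (qp q q k)⁻¹ * x ^ j), tsum_eq_sum (s := Finset.range (N + 1))]
    · exact (Finset.sum_congr rfl fun j hj => by rw [if_pos hj])
    · exact fun j hj => if_neg hj
  rw [← tsum_pow_mul_inv_qp hq hx, ← tsum_mul_left]
  simp only [funext hN]
  refine tendsto_tsum_of_dominated_convergence (bound := fun j => C * C * ‖x‖ ^ j)
    ((summable_geometric_of_lt_one (norm_nonneg x) hx).mul_left _) ?_ ?_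
  · intro j
    have h := (((tendsto_inv_qp_self hq).comp (tendsto_sub_atTop_nat j)).const_mul
      ((qp q q j)⁻¹)).mul_const (x ^ j)
    rw [show (qpInf q q)⁻¹ * (x ^ j * (qp q q j)⁻¹) = (qp q q j)⁻¹ * (qpInf q q)⁻¹ * x ^ j by ring]
    refine h.congr' ?_
    filter_upwards [eventually_ge_atTop j] with N hN
    rw [if_pos (Finset.mem_range.2 (Nat.lt_succ_of_le hN))]
    rfl
  · refine Eventually.of_forall fun N j => ?_
    split_ifs
    · rw [norm_mul, norm_mul, norm_pow]
      gcongr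
      · exact hC _
      · exact hC _
    · rw [norm_zero]; positivity

/-- Expansion of `₁φ̃₁(0;b;q,w)` along the antidiagonals of its double series. -/
lemma phiT_eq_tsum {q : ℂ} (hq : ‖q‖ < 1) (x y w : ℂ) :
    phiT q (x * w) (x * y) = ∑' N, thetaTerm q x N *
      ∑ p ∈ Finset.HasAntidiagonal.antidiagonal N, (qp q q p.1)⁻¹ * (qp q q p.2)⁻¹ * (w ^ p.1 * y ^ p.2) := by
  have hs (v : ℂ) := summable_norm_mul_inv_qp hq (summable_norm_thetaTerm hq v)
  set f : ℕ × ℕ → ℂ := fun p => thetaTerm q (x * y) p.2 * (qp q q p.2)⁻¹ *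
    (thetaTerm q (x * w * q ^ p.2) p.1 * (qp q q p.1)⁻¹) with hf
  have hsum : Summable f := by
    refine Summable.of_norm_bounded
      ((hs (x * w)).mul_of_nonneg (hs (x * y)) (fun _ => norm_nonneg _) fun _ => norm_nonneg _)
      fun p => ?_
    rw [mul_comm ‖_‖, norm_mul]
    refine mul_le_mul_of_nonneg_left ?_ (norm_nonneg _)
    rw [norm_mul, norm_mul]
    exact mul_le_mul_of_nonneg_right (norm_thetaTerm_mul_pow_le hq _ _ _) (norm_nonneg _)
  have h1 : phiT q (x * w) (x * y) = ∑' p, f p := by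
    rw [← (Equiv.prodComm ℕ ℕ).tsum_eq, Summable.tsum_prod, phiT]
    · refine tsum_congr fun k => ?_
      simp only [Equiv.prodComm_apply, hf, Prod.fst_swap, Prod.snd_swap]
      rw [tsum_mul_left, tsum_thetaTerm_mul_inv_qp hq, thetaTerm]
      ring
    · exact (Equiv.prodComm ℕ ℕ).summable_iff.2 hsum
  rw [h1, ← Finset.HasAntidiagonal.sigmaAntidiagonalEquivProd.tsum_eq, Summable.tsum_sigma']
  · refine tsum_congr fun N => ?_
    rw [tsum_fintype, Finset.mul_sum]
    refine (Finset.sum_congr rfl fun p _ => ?_).trans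
      (Finset.sum_coe_sort (Finset.HasAntidiagonal.antidiagonal N) fun p => thetaTerm q x N *
        ((qp q q p.1)⁻¹ * (qp q q p.2)⁻¹ * (w ^ p.1 * y ^ p.2)))
    obtain ⟨⟨j, k⟩, hp⟩ := p
    have hN := Finset.HasAntidiagonal.mem_antidiagonal.1 hp
    simp only [Finset.HasAntidiagonal.sigmaAntidiagonalEquivProd_apply, hf] at hN ⊢
    rw [← hN, thetaTerm_add, mul_comm x y, thetaTerm_mul,
      show x * w * q ^ k = w * (x * q ^ k) by ring, thetaTerm_mul]
    ring
  · exact fun N => (hasSum_fintype _).summable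
  · exact Finset.HasAntidiagonal.sigmaAntidiagonalEquivProd.summable_iff.2 hsum

/-- The bilateral theta coefficients `(-1)^M q^{M(M+1)/2} α^{-M}`. -/
noncomputable def thetaCoeff (q α : ℂ) (M : ℤ) : ℂ :=
  (-1) ^ M * α ^ (-M) * q ^ (M * (M + 1) / 2)

lemma thetaCoeff_zero (q α : ℂ) : thetaCoeff q α 0 = 1 := by simp [thetaCoeff]

lemma thetaCoeff_add_one {q α : ℂ} (hq0 : q ≠ 0) (hα : α ≠ 0) (M : ℤ) :
    thetaCoeff q α (M + 1) = -(q ^ (M + 1) / α) * thetaCoeff q α M := by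
  have h : (M + 1) * (M + 1 + 1) / 2 = M * (M + 1) / 2 + (M + 1) := by
    rw [show (M + 1) * (M + 1 + 1) = M * (M + 1) + (M + 1) * 2 by ring,
      Int.add_mul_ediv_right _ _ two_ne_zero]
  rw [thetaCoeff, thetaCoeff, h, neg_add, zpow_add₀ hq0, zpow_add₀ hα, zpow_add_one₀ (by simp),
    zpow_neg_one]
  ring

lemma thetaCoeff_add_natCast {q α : ℂ} (hq0 : q ≠ 0) (hα : α ≠ 0) (n : ℤ) (N : ℕ) :
    thetaCoeff q α (n + N) = thetaCoeff q α n * thetaTerm q (q ^ (n + 1) / α) N := by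
  induction N with
  | zero => simp
  | succ N ih =>
    rw [Nat.cast_succ, ← add_assoc, thetaCoeff_add_one hq0 hα, ih, thetaTerm_succ,
      show n + N + 1 = n + 1 + N by ring, zpow_add₀ hq0 (n + 1), zpow_natCast]
    ring

lemma thetaCoeff_neg_natCast {q α : ℂ} (hq0 : q ≠ 0) (hα : α ≠ 0) (N : ℕ) :
    thetaCoeff q α (-N) = thetaTerm q α N := by
  induction N with
  | zero => simp [thetaCoeff]
  | succ N ih =>
    have h := thetaCoeff_add_one hq0 hα (-((N + 1 : ℕ) : ℤ))
    rw [show -((N + 1 : ℕ) : ℤ) + 1 = -(N : ℤ) by push_cast; ring, ih, zpow_neg, zpow_natCast] at h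
    rw [thetaTerm_succ, h]
    field_simp

lemma hasSum_thetaCoeff {q α x : ℂ} (hq : ‖q‖ < 1) (hq0 : q ≠ 0) (hα : α ≠ 0) (hx : x ≠ 0) :
    HasSum (fun M : ℤ => thetaCoeff q α M * x ^ M) (thetaSeries q (α / x)) := by
  have e1 : (fun n : ℕ => thetaCoeff q α n * x ^ (n : ℤ)) = thetaTerm q (q / (α / x)) := by
    funext k
    have := thetaCoeff_add_natCast hq0 hα 0 k
    rw [zero_add, thetaCoeff_zero, zero_add, zpow_one, one_mul] at this
    rw [this, show q / (α / x) = x * (q / α) by field_simp, thetaTerm_mul, zpow_natCast, mul_comm]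
  have e2 : (fun n : ℕ => thetaCoeff q α (-n) * x ^ (-n : ℤ)) = thetaTerm q (α / x) := by
    funext k
    rw [thetaCoeff_neg_natCast hq0 hα, show α / x = x⁻¹ * α by field_simp, thetaTerm_mul, zpow_neg,
      zpow_natCast, inv_pow, mul_comm]
  have h1 := (summable_thetaTerm hq (q / (α / x))).hasSum
  have h2 := (summable_thetaTerm hq (α / x)).hasSum
  rw [← e1] at h1
  rw [← e2] at h2
  have h := HasSum.of_nat_of_neg (f := fun M : ℤ => thetaCoeff q α M * x ^ M) h1 h2
  rw [e1, e2] at h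
  rwa [thetaCoeff_zero, zpow_zero, mul_one, add_comm] at h

lemma fseq_eq_tsum {q α z : ℂ} (hq : ‖q‖ < 1) (hq0 : q ≠ 0) (hα : α ≠ 0) (hz : z ≠ 0) (n : ℤ) :
    fseq q α z n = ∑' N : ℕ, thetaCoeff q α (n + N) * (z ^ N * rogersSzego q (z⁻¹ ^ 2) N) := by
  rw [fseq, show q ^ (n + 1) / (α * z) = q ^ (n + 1) / α * z⁻¹ by field_simp,
    show z * q ^ (n + 1) / α = q ^ (n + 1) / α * z by ring, phiT_eq_tsum hq, ← tsum_mul_left]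
  refine tsum_congr fun N => ?_
  rw [thetaCoeff_add_natCast hq0 hα, ← thetaCoeff, mul_assoc, rogersSzego,
    Finset.mul_sum _ _ (z ^ N)]
  congr 2
  refine Finset.sum_congr rfl fun p hp => ?_
  have e : z ^ p.1 * (z⁻¹ ^ 2) ^ p.1 = z⁻¹ ^ p.1 := by
    rw [← mul_pow, show z * z⁻¹ ^ 2 = z⁻¹ by field_simp]
  rw [← Finset.HasAntidiagonal.mem_antidiagonal.1 hp, pow_add, ← e]
  ring

lemma tendsto_pow_mul_rogersSzego_sub {q z : ℂ} (hq : ‖q‖ < 1) (hz : ‖z‖ = 1) (hz2 : z ^ 2 ≠ 1) :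
    Tendsto (fun N : ℕ => z ^ N * rogersSzego q (z⁻¹ ^ 2) N -
      ((qpInf q q)⁻¹ * (qpInf q (z⁻¹ ^ 2))⁻¹ * z ^ N +
        (qpInf q q)⁻¹ * (qpInf q (z ^ 2))⁻¹ * z⁻¹ ^ N)) atTop (𝓝 0) := by
  have hz0 : z ≠ 0 := norm_ne_zero_iff.1 (by rw [hz]; exact one_ne_zero)
  have hd : 1 - z ^ 2 ≠ 0 := sub_ne_zero.2 hz2.symm
  have hd' : 1 - z⁻¹ ^ 2 ≠ 0 := by
    rw [inv_pow]
    exact sub_ne_zero.2 fun h => hz2 (inv_eq_one.1 h.symm)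
  have hlim {u x : ℂ} (hu : ‖u‖ = 1) (hx : ‖q * x‖ < 1) :
      Tendsto (fun N : ℕ => u ^ N * ((1 - x)⁻¹ * (rogersSzego q (q * x) (N + 1) -
        (qpInf q q)⁻¹ * (qpInf q (q * x))⁻¹))) atTop (𝓝 0) := by
    have h := (((tendsto_rogersSzego hq hx).comp (tendsto_add_atTop_nat 1)).sub_const
      ((qpInf q q)⁻¹ * (qpInf q (q * x))⁻¹)).const_mul ((1 - x)⁻¹)
    rw [sub_self, mul_zero] at h
    refine squeeze_zero_norm (fun N => ?_) (tendsto_zero_iff_norm_tendsto_zero.1 h)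
    rw [norm_mul, norm_pow, hu, one_pow, one_mul]
    rfl
  have h1 := hlim (u := z) (x := z⁻¹ ^ 2) hz (by simpa [hz] using hq)
  have h2 := hlim (u := z⁻¹) (x := z ^ 2) (by simp [hz]) (by simpa [hz] using hq)
  have h := h1.add h2
  rw [add_zero] at h
  refine h.congr fun N => ?_
  have hp : rogersSzego q (z⁻¹ ^ 2) N = (1 - z⁻¹ ^ 2)⁻¹ * (rogersSzego q (q * z⁻¹ ^ 2) (N + 1) -
      (z⁻¹ ^ 2) ^ (N + 1) * rogersSzego q (q * z ^ 2) (N + 1)) := by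
    rw [eq_inv_mul_iff_mul_eq₀ hd', one_sub_mul_rogersSzego hq (by simpa using hz0),
      inv_pow z 2, inv_inv]
  have hc : z ^ N * ((1 - z⁻¹ ^ 2)⁻¹ * (z⁻¹ ^ 2) ^ (N + 1)) = -(z⁻¹ ^ N * (1 - z ^ 2)⁻¹) := by
    have e : (1 - z⁻¹ ^ 2)⁻¹ * z⁻¹ ^ 2 = -(1 - z ^ 2)⁻¹ := by
      rw [inv_mul_eq_iff_eq_mul₀ hd', eq_comm, mul_neg, ← neg_mul, mul_inv_eq_iff_eq_mul₀ hd]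
      field_simp
      ring
    have e2 : z ^ N * (z⁻¹ ^ 2) ^ N = z⁻¹ ^ N := by
      rw [← mul_pow, show z * z⁻¹ ^ 2 = z⁻¹ by field_simp]
    rw [pow_succ]
    linear_combination (z ^ N * (z⁻¹ ^ 2) ^ N) * e - (1 - z ^ 2)⁻¹ * e2
  rw [hp, qpInf_eq_one_sub_mul hq (z⁻¹ ^ 2), qpInf_eq_one_sub_mul hq (z ^ 2), mul_inv (1 - z⁻¹ ^ 2),
    mul_inv (1 - z ^ 2)]
  linear_combination rogersSzego q (q * z ^ 2) (N + 1) * hc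

/-- Asymptotics of `f_n(z)` on the unit circle as `n → -∞`, in terms of theta series. -/
lemma tendsto_fseq_sub {q α z : ℂ} (hq : ‖q‖ < 1) (hq0 : q ≠ 0) (hα : α ≠ 0) (hz : ‖z‖ = 1)
    (hz2 : z ^ 2 ≠ 1) :
    Tendsto (fun n : ℤ => fseq q α z n -
      z ^ (-n) * ((qpInf q q)⁻¹ * (qpInf q (z⁻¹ ^ 2))⁻¹ * thetaSeries q (α / z)) -
      z ^ n * ((qpInf q q)⁻¹ * (qpInf q (z ^ 2))⁻¹ * thetaSeries q (α * z))) atBot (𝓝 0) := by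
  have hz0 : z ≠ 0 := norm_ne_zero_iff.1 (by rw [hz]; exact one_ne_zero)
  set a := (qpInf q q)⁻¹ * (qpInf q (z⁻¹ ^ 2))⁻¹
  set b := (qpInf q q)⁻¹ * (qpInf q (z ^ 2))⁻¹
  set W : ℤ → ℂ := fun N => if 0 ≤ N then z ^ N * rogersSzego q (z⁻¹ ^ 2) N.toNat else 0 with hW
  set V : ℤ → ℂ := fun N => W N - (a * z ^ N + b * z⁻¹ ^ N) with hV
  have hlim : Tendsto (fun N : ℕ => V N) atTop (𝓝 0) := by
    refine (tendsto_pow_mul_rogersSzego_sub hq hz hz2).congr fun N => ?_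
    simp [hV, hW, a, b]
  have hlimV : Tendsto V atTop (𝓝 0) := by
    rw [← Nat.map_cast_int_atTop, tendsto_map'_iff]
    exact hlim
  obtain ⟨C, hC0, hC⟩ := exists_norm_le_of_tendsto hlim
  have hVb (N : ℤ) : ‖V N‖ ≤ max C (‖a‖ + ‖b‖) := by
    rcases le_or_gt 0 N with h | h
    · lift N to ℕ using h
      exact (hC N).trans (le_max_left _ _)
    · refine le_trans ?_ (le_max_right _ _)
      simp only [hV, hW, if_neg h.not_ge, zero_sub, norm_neg]
      refine (norm_add_le _ _).trans (le_of_eq ?_)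
      simp [norm_zpow, hz]
  have hs1 := hasSum_thetaCoeff hq hq0 hα hz0
  have hs2 := hasSum_thetaCoeff hq hq0 hα (inv_ne_zero hz0)
  rw [div_inv_eq_mul] at hs2
  have hs : Summable fun M : ℤ => ‖thetaCoeff q α M‖ := by
    simpa using (hasSum_thetaCoeff hq hq0 hα one_ne_zero).summable.norm
  have hbound (n M : ℤ) : ‖thetaCoeff q α M * V (M - n)‖ ≤
      ‖thetaCoeff q α M‖ * max C (‖a‖ + ‖b‖) := by
    rw [norm_mul]
    exact mul_le_mul_of_nonneg_left (hVb _) (norm_nonneg _)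
  have hsV (n : ℤ) : Summable fun M : ℤ => thetaCoeff q α M * V (M - n) :=
    Summable.of_norm_bounded (hs.mul_right _) (hbound n)
  have hf (n : ℤ) : fseq q α z n = ∑' M : ℤ, thetaCoeff q α M * W (M - n) := by
    have hinj : Function.Injective fun N : ℕ => n + (N : ℤ) := fun i j h => by simpa using h
    rw [fseq_eq_tsum hq hq0 hα hz0, ← hinj.tsum_eq]
    · exact tsum_congr fun N => by simp [hW]
    · intro M hM
      by_contra hMn
      refine hM ?_
      have : ¬ 0 ≤ M - n := fun h => hMn ⟨(M - n).toNat, by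
        show n + (((M - n).toNat : ℕ) : ℤ) = M
        rw [Int.toNat_of_nonneg h]; ring⟩
      simp only [hW, if_neg this, mul_zero]
  have hkey (n : ℤ) : ∑' M : ℤ, thetaCoeff q α M * V (M - n) = fseq q α z n -
      z ^ (-n) * (a * thetaSeries q (α / z)) - z ^ n * (b * thetaSeries q (α * z)) := by
    have h := ((hsV n).hasSum.add (hs1.mul_left (z ^ (-n) * a))).add (hs2.mul_left (z ^ n * b))
    have e : (fun M : ℤ => thetaCoeff q α M * V (M - n) +
        z ^ (-n) * a * (thetaCoeff q α M * z ^ M) +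
        z ^ n * b * (thetaCoeff q α M * z⁻¹ ^ M)) =
        fun M : ℤ => thetaCoeff q α M * W (M - n) := by
      funext M
      simp only [hV]
      rw [inv_zpow', inv_zpow', neg_sub, sub_eq_add_neg M n, sub_eq_add_neg n M, zpow_add₀ hz0,
        zpow_add₀ hz0]
      ring
    rw [e] at h
    rw [hf, h.tsum_eq]
    ring
  refine Tendsto.congr hkey ?_
  have h := tendsto_tsum_of_dominated_convergence (𝓕 := atBot)
    (f := fun (n : ℤ) M => thetaCoeff q α M * V (M - n)) (g := fun _ => (0 : ℂ))
    (hs.mul_right (max C (‖a‖ + ‖b‖))) ?_ (Eventually.of_forall hbound)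
  · simpa using h
  · intro M
    have hM : Tendsto (fun n : ℤ => M - n) atBot atTop := by
      simpa only [sub_eq_add_neg] using tendsto_atTop_add_const_left atBot M tendsto_neg_atBot_atTop
    simpa using (hlimV.comp hM).const_mul (thetaCoeff q α M)

theorem stmt_14 (q : ℝ) (hq0 : 0 < q) (hq1 : q < 1) (α : ℝ) (hα : q < α) (hα1 : α ≤ 1)
    (φ : ℝ) (hφ : φ ∈ Set.Ioo 0 Real.pi) (A B : ℂ)
    (hA : A = qpInf (q : ℂ) ((q : ℂ) * (α : ℂ)⁻¹ * Complex.exp (-(Complex.I * φ))) /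
        qpInf (q : ℂ) (q : ℂ) *
      (-(Complex.I * Complex.exp (Complex.I * φ) / (2 * Real.sin φ)) *
          phiOne (q : ℂ) ((q : ℂ) * Complex.exp (-(2 * Complex.I * φ)))
            ((α : ℂ) * Complex.exp (-(Complex.I * φ))) +
        phiOne (q : ℂ) ((q : ℂ) * (α : ℂ)⁻¹ * Complex.exp (-(Complex.I * φ)))
          ((q : ℂ) * (α : ℂ)⁻¹ * Complex.exp (Complex.I * φ)) - 1))
    (hB : B = theta (q : ℂ) ((α : ℂ) * Complex.exp (Complex.I * φ)) /
        qpInf (q : ℂ) (Complex.exp (2 * Complex.I * φ))) :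
    Tendsto (fun n : ℤ =>
        fseq (q : ℂ) (α : ℂ) (Complex.exp (Complex.I * φ)) n -
          Complex.exp (-(Complex.I * n * φ)) * A - Complex.exp (Complex.I * n * φ) * B)
      atBot (nhds 0) := by
  have hq : ‖(q : ℂ)‖ < 1 := by rwa [norm_real, Real.norm_of_nonneg hq0.le]
  have hqC : (q : ℂ) ≠ 0 := ofReal_ne_zero.2 hq0.ne'
  have hα0 : 0 < α := hq0.trans hα
  have hαC : (α : ℂ) ≠ 0 := ofReal_ne_zero.2 hα0.ne'
  set z : ℂ := Complex.exp (Complex.I * φ) with hzdef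
  have hz : ‖z‖ = 1 := by rw [hzdef, mul_comm, norm_exp_ofReal_mul_I]
  have hz0 : z ≠ 0 := exp_ne_zero _
  have hsin : (Real.sin φ : ℂ) ≠ 0 := ofReal_ne_zero.2 (Real.sin_pos_of_mem_Ioo hφ).ne'
  have hsinz : 2 * Complex.I * (Real.sin φ : ℂ) = z - z⁻¹ := by
    rw [ofReal_sin, Complex.sin, hzdef, ← Complex.exp_neg, mul_comm Complex.I, neg_mul]
    linear_combination (Complex.exp (-(φ * Complex.I)) - Complex.exp (φ * Complex.I)) * I_sq
  have hzz : z - z⁻¹ ≠ 0 := by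
    rw [← hsinz]
    exact mul_ne_zero (mul_ne_zero two_ne_zero I_ne_zero) hsin
  have hz2 : z ^ 2 ≠ 1 := fun h =>
    hzz (sub_eq_zero.2 (eq_inv_of_mul_eq_one_left (by rw [← sq, h])))
  have e1 : Complex.exp (-(Complex.I * φ)) = z⁻¹ := Complex.exp_neg _
  have e2 : Complex.exp (2 * Complex.I * φ) = z ^ 2 := by
    rw [hzdef, ← Complex.exp_nat_mul]
    push_cast
    ring_nf
  have e3 : Complex.exp (-(2 * Complex.I * φ)) = z⁻¹ ^ 2 := by rw [Complex.exp_neg, e2, inv_pow]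
  have e4 (n : ℤ) : Complex.exp (Complex.I * n * φ) = z ^ n := by
    rw [hzdef, ← Complex.exp_int_mul]
    ring_nf
  have e5 (n : ℤ) : Complex.exp (-(Complex.I * n * φ)) = z ^ (-n) := by
    rw [Complex.exp_neg, e4, zpow_neg]
  have hpre : -(Complex.I * z / (2 * (Real.sin φ : ℂ))) = (1 - z⁻¹ ^ 2)⁻¹ := by
    have h1 : 1 - z⁻¹ ^ 2 = z⁻¹ * (z - z⁻¹) := by field_simp
    rw [h1, ← hsinz]
    field_simp
    rw [I_sq, neg_neg]
  have hw : qpInf (q : ℂ) (z⁻¹ ^ 2) ≠ 0 := by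
    rw [qpInf_eq_one_sub_mul hq]
    refine mul_ne_zero ?_ (qpInf_ne_zero_of_norm_lt hq (by simpa [hz] using hq))
    rw [inv_pow]
    exact sub_ne_zero.2 fun h => hz2 (inv_eq_one.1 h.symm)
  have hqq : qpInf (q : ℂ) q ≠ 0 := qpInf_ne_zero_of_norm_lt hq hq
  have hby : (q : ℂ) * z⁻¹ ^ 2 / (α * z⁻¹) = q * (α : ℂ)⁻¹ * z⁻¹ := by field_simp
  have hx : qpInf (q : ℂ) (q * (α : ℂ)⁻¹ * z⁻¹) ≠ 0 := by
    refine qpInf_ne_zero_of_norm_lt hq ?_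
    rw [norm_mul, norm_mul, norm_inv, norm_inv, hz, norm_real, norm_real,
      Real.norm_of_nonneg hq0.le, Real.norm_of_nonneg hα0.le, inv_one, mul_one,
      ← div_eq_mul_inv, div_lt_one hα0]
    exact hα
  have hA' : A = (qpInf (q : ℂ) q)⁻¹ * (qpInf (q : ℂ) (z⁻¹ ^ 2))⁻¹ * thetaSeries q (α / z) := by
    have h := phiOne_add_phiOne hq hqC (mul_ne_zero hαC (inv_ne_zero hz0)) hw (by rwa [hby])
    rw [hby, show (q : ℂ) / (α * z⁻¹) = q * (α : ℂ)⁻¹ * z by field_simp] at h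
    rw [hA, e1, e3, hpre, div_mul_eq_mul_div, h, div_eq_mul_inv (α : ℂ)]
    field_simp
  have hB' : B = (qpInf (q : ℂ) q)⁻¹ * (qpInf (q : ℂ) (z ^ 2))⁻¹ * thetaSeries q (α * z) := by
    rw [hB, e2, thetaSeries_eq hq (mul_ne_zero hαC hz0) hqC]
    field_simp
  simp only [e4, e5]
  rw [hA', hB']
  exact tendsto_fseq_sub hq hqC hαC hz hz2
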